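/- Let K ⊂ ℝⁿ be a proper cone admitting a ν-LHSCB F with conjugate F_*. Let x₊ ∈ int K, s₊ ∈ int K*, τ₊, κ₊ > 0, and let W₊ be a symmetric positive definite matrix with W₊·x₊ = s₊, W₊·x̃₊ = s̃₊, and (lD₊/μ₊)·F_*''(s₊)⁻¹ ⪯ W₊ ⪯ (uD₊/μ₊)·F_*''(s₊)⁻¹, where uD₊ = (1+ε)/λ and lD₊ = λ·(1−ε) for some λ ∈ (0,1] and ε ≥ 0. Let Δx, Δs ∈ ℝⁿ and Δτ, Δκ ∈ ℝ satisfy W₊·Δx + Δs = μ₊·s̃₊ − s₊, τ₊·Δκ + κ₊·Δτ = 0, and ⟨Δx, Δs⟩ + Δτ·Δκ = 0, and suppose ‖δP₊‖_{W₊}/√μ₊ < √(min{lD₊, 1/uD₊}), x₊ + Δx ∈ int K, and s₊ + Δs ∈ int K*. Define μ̃₊₊ := ⟨−F_*'(s₊ + Δs), −F'(x₊ + Δx)⟩/ν and d := ‖δP₊‖_{W₊}. Then μ₊·μ̃₊₊ ≤ 1 + d·[(‖x̃₊‖_{W₊}/ν)·(1/(lD₊·(1 − d/√(lD₊·μ₊)))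 − 1) + (uD₊/√(μ₊·ν))·(1/(1 − √(uD₊/μ₊)·d) − 1)] + d²·uD₊/(μ₊·ν·lD₊·(1 − d/√(lD₊·μ₊))·(1 − √(uD₊/μ₊)·d)). -/

import Mathlib

open Matrix

/-- The norm induced by a (positive definite) matrix `P`: `‖v‖_P = √(vᵀ P v)`. -/
noncomputable def vnorm {n : ℕ} (P : Matrix (Fin n) (Fin n) ℝ) (v : Fin n → ℝ) : ℝ :=
  Real.sqrt (v ⬝ᵥ (P *ᵥ v))

/-- The operator norm `‖Q‖_P = sup {‖Q u‖_{P⁻¹} : ‖u‖_P ≤ 1}`. -/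
noncomputable def opNorm {n : ℕ} (P Q : Matrix (Fin n) (Fin n) ℝ) : ℝ :=
  sSup ((fun u => vnorm P⁻¹ (Q *ᵥ u)) '' {u : Fin n → ℝ | vnorm P u ≤ 1})

/-- The Loewner order: `Loewner P Q` means `P ⪯ Q`, i.e. `Q - P` is positive semidefinite. -/
def Loewner {n : ℕ} (P Q : Matrix (Fin n) (Fin n) ℝ) : Prop :=
  (Q - P).PosSemidef

/-- A ν-logarithmically homogeneous self-concordant barrier `F` for a proper cone `K ⊆ ℝⁿ`,
with gradient `grad` and Hessian `hess`. -/
structure LHSCB (n : ℕ) (ν : ℝ) where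
  K : Set (Fin n → ℝ)
  F : (Fin n → ℝ) → ℝ
  grad : (Fin n → ℝ) → (Fin n → ℝ)
  hess : (Fin n → ℝ) → Matrix (Fin n) (Fin n) ℝ
  nu_ge_one : 1 ≤ ν
  cone_convex : Convex ℝ K
  cone_closed : IsClosed K
  cone_pointed : ∀ x, x ∈ K → -x ∈ K → x = 0
  cone_fullDim : (interior K).Nonempty
  cone_smul : ∀ t : ℝ, 0 < t → ∀ x ∈ K, t • x ∈ K
  smooth : ContDiffOn ℝ 3 F (interior K)
  strictConvex : StrictConvexOn ℝ (interior K) F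
  grad_eq : ∀ x ∈ interior K, ∀ v, fderiv ℝ F x v = grad x ⬝ᵥ v
  hess_eq : ∀ x ∈ interior K, ∀ u, fderiv ℝ grad x u = hess x *ᵥ u
  hess_symm : ∀ x ∈ interior K, (hess x).IsSymm
  hess_posdef : ∀ x ∈ interior K, (hess x).PosDef
  logHom : ∀ t : ℝ, 0 < t → ∀ x ∈ interior K, F (t • x) = F x - ν * Real.log t
  dikin : ∀ x ∈ interior K, ∀ y, vnorm (hess x) (y - x) < 1 → y ∈ interior K
  selfConc : ∀ x ∈ interior K, ∀ x' ∈ interior K, vnorm (hess x) (x' - x) < 1 →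
    Loewner ((1 - vnorm (hess x) (x' - x)) ^ 2 • hess x') (hess x) ∧
    Loewner (hess x) (((1 - vnorm (hess x) (x' - x)) ^ 2)⁻¹ • hess x')

/-- A ν-LHSCB `B` for a proper cone `K` together with its conjugate barrier `Bstar`
(a ν-LHSCB for the dual cone `K*`, equal on `int K*` to the convex conjugate of `B.F`). -/
structure LHSCBPair (n : ℕ) (ν : ℝ) where
  B : LHSCB n ν
  Bstar : LHSCB n ν
  dual_eq : Bstar.K = {s | ∀ x ∈ B.K, 0 ≤ x ⬝ᵥ s}
  conj_eq : ∀ s ∈ interior Bstar.K,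
    Bstar.F s = sSup ((fun x => -(s ⬝ᵥ x) - B.F x) '' interior B.K)

section LinearAlgebra

variable {n : ℕ}

theorem vnorm_nonneg (P : Matrix (Fin n) (Fin n) ℝ) (v : Fin n → ℝ) : 0 ≤ vnorm P v :=
  Real.sqrt_nonneg _

theorem quadForm_nonneg {P : Matrix (Fin n) (Fin n) ℝ} (hP : P.PosSemidef) (v : Fin n → ℝ) :
    0 ≤ v ⬝ᵥ P *ᵥ v := by
  simpa using hP.dotProduct_mulVec_nonneg v

theorem vnorm_sq {P : Matrix (Fin n) (Fin n) ℝ} (hP : P.PosSemidef) (v : Fin n → ℝ) :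
    vnorm P v ^ 2 = v ⬝ᵥ P *ᵥ v :=
  Real.sq_sqrt (quadForm_nonneg hP v)

theorem vnorm_pos {P : Matrix (Fin n) (Fin n) ℝ} (hP : P.PosDef) {v : Fin n → ℝ} (hv : v ≠ 0) :
    0 < vnorm P v :=
  Real.sqrt_pos.mpr (by simpa using hP.dotProduct_mulVec_pos hv)

theorem vnorm_smul (P : Matrix (Fin n) (Fin n) ℝ) (t : ℝ) (v : Fin n → ℝ) :
    vnorm P (t • v) = |t| * vnorm P v := by
  unfold vnorm
  rw [mulVec_smul, smul_dotProduct, dotProduct_smul, smul_eq_mul, smul_eq_mul, ← mul_assoc,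
    ← sq, Real.sqrt_mul (sq_nonneg t), Real.sqrt_sq_eq_abs]

theorem Loewner.quadForm_le {P Q : Matrix (Fin n) (Fin n) ℝ} (h : Loewner P Q) (v : Fin n → ℝ) :
    v ⬝ᵥ P *ᵥ v ≤ v ⬝ᵥ Q *ᵥ v := by
  have := quadForm_nonneg h v
  rw [sub_mulVec, dotProduct_sub] at this
  linarith

theorem Matrix.IsSymm.dotProduct_mulVec_comm {M : Matrix (Fin n) (Fin n) ℝ} (hM : M.IsSymm)
    (u v : Fin n → ℝ) : u ⬝ᵥ M *ᵥ v = v ⬝ᵥ M *ᵥ u := by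
  rw [dotProduct_comm u, ← vecMul_transpose, hM.eq, ← dotProduct_mulVec]

/-- A symmetric form bounded by `c • Q` on the diagonal is bounded off the diagonal as well. -/
theorem dotProduct_mulVec_le_of_abs_quadForm_le {M Q : Matrix (Fin n) (Fin n) ℝ}
    (hM : M.IsSymm) (hQ : Q.PosDef) {c : ℝ}
    (h : ∀ v, |v ⬝ᵥ M *ᵥ v| ≤ c * (v ⬝ᵥ Q *ᵥ v)) (u v : Fin n → ℝ) :
    u ⬝ᵥ M *ᵥ v ≤ c * (vnorm Q u * vnorm Q v) := by
  rcases eq_or_ne u 0 with rfl | hu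
  · simp [vnorm]
  rcases eq_or_ne v 0 with rfl | hv
  · simp [vnorm]
  have key : ∀ a b : ℝ, 2 * (a * b * (u ⬝ᵥ M *ᵥ v)) ≤
      c * (a ^ 2 * (u ⬝ᵥ Q *ᵥ u) + b ^ 2 * (v ⬝ᵥ Q *ᵥ v)) := by
    intro a b
    have h1 := (abs_le.mp (h (a • u + b • v))).2
    have h2 := (abs_le.mp (h (a • u - b • v))).1
    have e1 := hM.dotProduct_mulVec_comm v u
    simp only [mulVec_add, mulVec_sub, mulVec_smul, dotProduct_add, dotProduct_sub,
      add_dotProduct, sub_dotProduct, smul_dotProduct, dotProduct_smul, smul_eq_mul, e1]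
      at h1 h2
    linarith
  have ha := vnorm_pos hQ hu
  have hb := vnorm_pos hQ hv
  have h1 := key (vnorm Q v) (vnorm Q u)
  rw [← vnorm_sq hQ.posSemidef, ← vnorm_sq hQ.posSemidef] at h1
  have hab := mul_pos ha hb
  refine le_of_mul_le_mul_left ?_ hab
  nlinarith

theorem dotProduct_mulVec_le_vnorm_mul {Q : Matrix (Fin n) (Fin n) ℝ} (hQs : Q.IsSymm)
    (hQ : Q.PosDef) (u v : Fin n → ℝ) : u ⬝ᵥ Q *ᵥ v ≤ vnorm Q u * vnorm Q v := by
  have := dotProduct_mulVec_le_of_abs_quadForm_le (c := 1) hQs hQ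
    (fun v => by rw [abs_of_nonneg (quadForm_nonneg hQ.posSemidef v), one_mul]) u v
  rwa [one_mul] at this

/-- If `G ⪯ c • H` and `H * D = 1`, then the `D`-norm of `G v` is at most `√c` times the
`G`-norm of `v`. -/
theorem vnorm_mulVec_le {G H D : Matrix (Fin n) (Fin n) ℝ} (hGs : G.IsSymm) (hG : G.PosDef)
    (hD : D.PosDef) (hHD : H * D = 1) {c : ℝ} (hc : 0 ≤ c)
    (h : ∀ v, v ⬝ᵥ G *ᵥ v ≤ c * (v ⬝ᵥ H *ᵥ v)) (v : Fin n → ℝ) :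
    vnorm D (G *ᵥ v) ≤ √c * vnorm G v := by
  set p := D *ᵥ (G *ᵥ v) with hp
  have hX := vnorm_sq hD.posSemidef (G *ᵥ v)
  set X := vnorm D (G *ᵥ v)
  have hX0 : 0 ≤ X := vnorm_nonneg _ _
  have h1 : X ^ 2 = p ⬝ᵥ G *ᵥ v := by rw [hX, dotProduct_comm]
  have h2 : p ⬝ᵥ H *ᵥ p = X ^ 2 := by
    rw [h1, hp, mulVec_mulVec _ H D, hHD, one_mulVec]
  have h3 := dotProduct_mulVec_le_vnorm_mul hGs hG p v
  have h4 : vnorm G p ≤ √c * X := by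
    unfold vnorm
    calc √(p ⬝ᵥ G *ᵥ p) ≤ √(c * X ^ 2) := Real.sqrt_le_sqrt (by rw [← h2]; exact h p)
      _ = √c * X := by rw [Real.sqrt_mul hc, Real.sqrt_sq hX0]
  have hv := vnorm_nonneg G v
  rcases hX0.eq_or_lt with h0 | h0
  · rw [← h0]; positivity
  · refine le_of_mul_le_mul_left ?_ h0
    nlinarith [mul_le_mul_of_nonneg_right h4 hv]

end LinearAlgebra

namespace LHSCB

variable {n : ℕ} {ν : ℝ}

theorem nu_pos (B : LHSCB n ν) : 0 < ν := lt_of_lt_of_le one_pos B.nu_ge_one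

theorem zero_notMem (B : LHSCB n ν) : (0 : Fin n → ℝ) ∉ interior B.K := by
  intro h
  have h1 := B.logHom 2 two_pos 0 h
  rw [smul_zero] at h1
  have h2 := mul_pos B.nu_pos (Real.log_pos one_lt_two)
  linarith

open scoped Pointwise in
theorem smul_mem_interior (B : LHSCB n ν) {t : ℝ} (ht : 0 < t) {x : Fin n → ℝ}
    (hx : x ∈ interior B.K) : t • x ∈ interior B.K := by
  have h1 : t • interior B.K ⊆ interior B.K := by
    refine interior_maximal ?_ (isOpen_interior.smul₀ ht.ne')
    rintro _ ⟨y, hy, rfl⟩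
    exact B.cone_smul t ht y (interior_subset hy)
  exact h1 (Set.smul_mem_smul_set hx)

theorem differentiableAt (B : LHSCB n ν) {x : Fin n → ℝ} (hx : x ∈ interior B.K) :
    DifferentiableAt ℝ B.F x :=
  (B.smooth.differentiableOn (by norm_num)).differentiableAt (isOpen_interior.mem_nhds hx)

theorem grad_apply (B : LHSCB n ν) {x : Fin n → ℝ} (hx : x ∈ interior B.K) (i : Fin n) :
    B.grad x i = fderiv ℝ B.F x (Pi.single i 1) := by
  rw [B.grad_eq x hx, dotProduct_single, mul_one]

theorem grad_differentiableAt (B : LHSCB n ν) {x : Fin n → ℝ} (hx : x ∈ interior B.K) :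
    DifferentiableAt ℝ B.grad x := by
  rw [differentiableAt_pi]
  intro i
  have h1 : ContDiffOn ℝ 2 (fderiv ℝ B.F) (interior B.K) :=
    B.smooth.fderiv_of_isOpen isOpen_interior (by norm_num)
  have h2 : DifferentiableAt ℝ (fderiv ℝ B.F) x :=
    (h1.differentiableOn (by norm_num)).differentiableAt (isOpen_interior.mem_nhds hx)
  refine (h2.clm_apply (differentiableAt_const (Pi.single i (1 : ℝ)))).congr_of_eventuallyEq ?_
  filter_upwards [isOpen_interior.mem_nhds hx] with y hy using B.grad_apply hy i

/-- The derivative of `F` along a curve. -/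
theorem hasDerivAt_comp (B : LHSCB n ν) {γ : ℝ → Fin n → ℝ} {h : Fin n → ℝ} {t : ℝ}
    (hγ : HasDerivAt γ h t) (ht : γ t ∈ interior B.K) :
    HasDerivAt (fun τ => B.F (γ τ)) (B.grad (γ t) ⬝ᵥ h) t := by
  have := (B.differentiableAt ht).hasFDerivAt.comp_hasDerivAt t hγ
  rwa [B.grad_eq _ ht] at this

/-- The derivative of the gradient along a curve. -/
theorem hasDerivAt_grad_comp (B : LHSCB n ν) {γ : ℝ → Fin n → ℝ} {h : Fin n → ℝ} {t : ℝ}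
    (hγ : HasDerivAt γ h t) (ht : γ t ∈ interior B.K) :
    HasDerivAt (fun τ => B.grad (γ τ)) (B.hess (γ t) *ᵥ h) t := by
  have := (B.grad_differentiableAt ht).hasFDerivAt.comp_hasDerivAt t hγ
  rwa [B.hess_eq _ ht] at this

theorem hasDerivAt_line (x h : Fin n → ℝ) (t : ℝ) :
    HasDerivAt (fun τ : ℝ => x + τ • h) h t := by
  simpa using ((hasDerivAt_id t).smul_const h).const_add x

theorem _root_.HasDerivAt.dotProduct_const_left {γ : ℝ → Fin n → ℝ} {h : Fin n → ℝ} {t : ℝ}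
    (u : Fin n → ℝ) (hγ : HasDerivAt γ h t) :
    HasDerivAt (fun τ => u ⬝ᵥ γ τ) (u ⬝ᵥ h) t := by
  unfold dotProduct
  exact HasDerivAt.fun_sum fun i _ => ((hasDerivAt_pi.mp hγ) i).const_mul (u i)

/-- The gradient is homogeneous of degree `-1`. -/
theorem smul_grad_smul (B : LHSCB n ν) {t : ℝ} (ht : 0 < t) {x : Fin n → ℝ}
    (hx : x ∈ interior B.K) : t • B.grad (t • x) = B.grad x := by
  refine dotProduct_eq _ _ fun v => ?_
  have hγ := hasDerivAt_line x v 0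
  have hγ0 : x + (0 : ℝ) • v ∈ interior B.K := by simpa using hx
  have h1 := B.hasDerivAt_comp (hγ.const_smul t)
    (by simpa using B.smul_mem_interior ht hx)
  have h2 := (B.hasDerivAt_comp hγ hγ0).sub_const (ν * Real.log t)
  have h3 := h2.congr_of_eventuallyEq (f₁ := fun τ => B.F (t • (x + τ • v))) (by
    filter_upwards [hγ.continuousAt.preimage_mem_nhds (isOpen_interior.mem_nhds hγ0)] with τ hτ
    exact B.logHom t ht _ hτ)
  have h4 := h1.unique h3
  simpa [dotProduct_smul, smul_dotProduct] using h4

theorem grad_dotProduct_self (B : LHSCB n ν) {x : Fin n → ℝ} (hx : x ∈ interior B.K) :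
    B.grad x ⬝ᵥ x = -ν := by
  have hγ : HasDerivAt (fun τ : ℝ => τ • x) x 1 := by
    simpa using (hasDerivAt_id (1 : ℝ)).smul_const x
  have h1 := B.hasDerivAt_comp hγ (by simpa using hx)
  have h2 := ((Real.hasDerivAt_log one_ne_zero).const_mul ν).const_sub (B.F x)
  have h3 := h2.congr_of_eventuallyEq (f₁ := fun τ : ℝ => B.F (τ • x)) (by
    filter_upwards [lt_mem_nhds (zero_lt_one' ℝ)] with τ hτ using B.logHom τ hτ x hx)
  simpa using h1.unique h3

theorem hess_mulVec_self (B : LHSCB n ν) {x : Fin n → ℝ} (hx : x ∈ interior B.K) :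
    B.hess x *ᵥ x = -B.grad x := by
  have hγ : HasDerivAt (fun τ : ℝ => τ • x) x 1 := by
    simpa using (hasDerivAt_id (1 : ℝ)).smul_const x
  have h1 := B.hasDerivAt_grad_comp hγ (by simpa using hx)
  have h2 := (hasDerivAt_inv (one_ne_zero' ℝ)).smul_const (B.grad x)
  have h3 := h2.congr_of_eventuallyEq (f₁ := fun τ : ℝ => B.grad (τ • x)) (by
    filter_upwards [lt_mem_nhds (zero_lt_one' ℝ)] with τ hτ
    rw [← B.smul_grad_smul hτ hx, smul_smul, inv_mul_cancel₀ hτ.ne', one_smul])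
  simpa using h1.unique h3

theorem line_mem (B : LHSCB n ν) {x h : Fin n → ℝ} (hx : x ∈ interior B.K)
    (hr : vnorm (B.hess x) h < 1) {t : ℝ} (ht : t ∈ Set.Icc (0 : ℝ) 1) :
    x + t • h ∈ interior B.K := by
  refine B.dikin x hx _ ?_
  rw [add_sub_cancel_left, vnorm_smul, abs_of_nonneg ht.1]
  nlinarith [vnorm_nonneg (B.hess x) h, ht.2]

theorem one_sub_mul_pos {r t : ℝ} (hr : r < 1) (ht : t ∈ Set.Icc (0 : ℝ) 1) : 0 < 1 - t * r := by
  rcases le_or_gt r 0 with h | h <;> nlinarith [ht.1, ht.2]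

/-- The Hessian along a segment inside the Dikin ellipsoid. -/
theorem hess_line_bounds (B : LHSCB n ν) {x h : Fin n → ℝ} (hx : x ∈ interior B.K) {r : ℝ}
    (hhr : vnorm (B.hess x) h ≤ r) (hr : r < 1) {t : ℝ} (ht : t ∈ Set.Icc (0 : ℝ) 1)
    (v : Fin n → ℝ) :
    (1 - t * r) ^ 2 * (v ⬝ᵥ B.hess x *ᵥ v) ≤ v ⬝ᵥ B.hess (x + t • h) *ᵥ v ∧
    v ⬝ᵥ B.hess (x + t • h) *ᵥ v ≤ ((1 - t * r) ^ 2)⁻¹ * (v ⬝ᵥ B.hess x *ᵥ v) := by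
  have hz := B.line_mem hx (hhr.trans_lt hr) ht
  have hn : vnorm (B.hess x) (x + t • h - x) = t * vnorm (B.hess x) h := by
    rw [add_sub_cancel_left, vnorm_smul, abs_of_nonneg ht.1]
  have hpos := one_sub_mul_pos hr ht
  have hle : t * vnorm (B.hess x) h ≤ t * r := mul_le_mul_of_nonneg_left hhr ht.1
  obtain ⟨h1, h2⟩ := B.selfConc x hx _ hz (by rw [hn]; linarith)
  rw [hn] at h1 h2
  have h1 := h1.quadForm_le v
  have h2 := h2.quadForm_le v
  simp only [smul_mulVec, dotProduct_smul, smul_eq_mul] at h1 h2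
  have hq := quadForm_nonneg (B.hess_posdef _ hx).posSemidef v
  have hq' := quadForm_nonneg (B.hess_posdef _ hz).posSemidef v
  have hsq : (1 - t * r) ^ 2 ≤ (1 - t * vnorm (B.hess x) h) ^ 2 := by gcongr
  have hsp : 0 < (1 - t * r) ^ 2 := by positivity
  constructor
  · rw [← div_eq_inv_mul, le_div_iff₀ (hsp.trans_le hsq)] at h2
    nlinarith
  · rw [← div_eq_inv_mul, le_div_iff₀ hsp]
    nlinarith

/-- Integrating a pointwise bound on the Hessian along a segment. -/
theorem dotProduct_grad_sub_le (B : LHSCB n ν) {x h : Fin n → ℝ} {r : ℝ} (hr : r < 1)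
    (hmem : ∀ t ∈ Set.Icc (0 : ℝ) 1, x + t • h ∈ interior B.K) {u : Fin n → ℝ} {g a b : ℝ}
    (hb : ∀ t ∈ Set.Icc (0 : ℝ) 1,
      g - u ⬝ᵥ B.hess (x + t • h) *ᵥ h ≤ a * ((1 - t * r) ^ 2)⁻¹ - b) :
    g - u ⬝ᵥ (B.grad (x + h) - B.grad x) ≤ a * (1 - r)⁻¹ - b := by
  have hd : ∀ t ∈ Set.Icc (0 : ℝ) 1, HasDerivAt
      (fun τ => (a * (τ * (1 - τ * r)⁻¹) - τ * b) - (τ * g - u ⬝ᵥ B.grad (x + τ • h)))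
      ((a * ((1 - t * r) ^ 2)⁻¹ - b) - (g - u ⬝ᵥ B.hess (x + t • h) *ᵥ h)) t := by
    intro t ht
    have hne := (one_sub_mul_pos hr ht).ne'
    have h1 : HasDerivAt (fun τ : ℝ => τ * (1 - τ * r)⁻¹) ((1 - t * r) ^ 2)⁻¹ t := by
      have h0 : HasDerivAt (fun τ : ℝ => 1 - τ * r) (-(1 * r)) t :=
        ((hasDerivAt_id t).mul_const r).const_sub 1
      refine ((hasDerivAt_id' t).fun_mul (h0.fun_inv hne)).congr_deriv ?_
      field_simp
      ring
    have h2 := (B.hasDerivAt_grad_comp (hasDerivAt_line x h t)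
      (hmem t ht)).dotProduct_const_left u
    have h3 := (((h1.const_mul a).sub ((hasDerivAt_id t).mul_const b)).sub
      (((hasDerivAt_id t).mul_const g).sub h2))
    exact h3.congr_deriv (by simp)
  have hmono := monotoneOn_of_deriv_nonneg (convex_Icc (0 : ℝ) 1)
    (fun t ht => (hd t ht).continuousAt.continuousWithinAt)
    (fun t ht => (hd t (interior_subset ht)).differentiableAt.differentiableWithinAt)
    (fun t ht => by
      rw [(hd t (interior_subset ht)).deriv]
      linarith [hb t (interior_subset ht)])
  have := hmono (Set.left_mem_Icc.mpr zero_le_one) (Set.right_mem_Icc.mpr zero_le_one) zero_le_one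
  simp only [zero_mul, zero_smul, add_zero, one_mul, one_smul, mul_zero] at this
  rw [dotProduct_sub]
  linarith

end LHSCB

/-- The ellipsoids defined by a positive definite matrix are compact. -/
theorem isCompact_setOf_vnorm_sub_le {n : ℕ} {H : Matrix (Fin n) (Fin n) ℝ} (hHs : H.IsSymm)
    (hH : H.PosDef) (x : Fin n → ℝ) (R : ℝ) : IsCompact {y | vnorm H (y - x) ≤ R} := by
  have hcont : Continuous fun y => vnorm H (y - x) := by
    unfold vnorm
    fun_prop
  have hcoord : ∀ (v : Fin n → ℝ) (i : Fin n),
      |v i| ≤ vnorm H (H⁻¹ *ᵥ Pi.single i 1) * vnorm H v := by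
    have hle : ∀ (v : Fin n → ℝ) (i : Fin n),
        v i ≤ vnorm H (H⁻¹ *ᵥ Pi.single i 1) * vnorm H v := by
      intro v i
      have h1 := dotProduct_mulVec_le_vnorm_mul hHs hH (H⁻¹ *ᵥ Pi.single i 1) v
      rwa [hHs.dotProduct_mulVec_comm, mulVec_mulVec,
        mul_nonsing_inv _ ((isUnit_iff_isUnit_det _).mp hH.isUnit), one_mulVec,
        dotProduct_single, mul_one] at h1
    intro v i
    refine abs_le'.mpr ⟨hle v i, ?_⟩
    have h1 := hle ((-1 : ℝ) • v) i
    rw [vnorm_smul] at h1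
    simpa using h1
  refine (isCompact_univ_pi fun i => isCompact_Icc
    (a := x i - vnorm H (H⁻¹ *ᵥ Pi.single i 1) * R)
    (b := x i + vnorm H (H⁻¹ *ᵥ Pi.single i 1) * R)).of_isClosed_subset
    (isClosed_le hcont continuous_const) ?_
  intro y hy i _
  have h1 := hcoord (y - x) i
  have h2 := mul_le_mul_of_nonneg_left hy (vnorm_nonneg H (H⁻¹ *ᵥ Pi.single i 1))
  have h3 := abs_le.mp (h1.trans h2)
  rw [Pi.sub_apply] at h3
  exact ⟨by linarith [h3.1], by linarith [h3.2]⟩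

namespace LHSCB

variable {n : ℕ} {ν : ℝ}

/-- Strong midpoint convexity of a linear perturbation of a barrier along a vector of local norm
`1 / 2`. -/
theorem midpoint_le (B : LHSCB n ν) (s : Fin n → ℝ) {x h : Fin n → ℝ} (hx : x ∈ interior B.K)
    (hh : vnorm (B.hess x) h = 1 / 2) :
    s ⬝ᵥ (x + (1 / 2 : ℝ) • h) + B.F (x + (1 / 2 : ℝ) • h) ≤
      ((s ⬝ᵥ x + B.F x) + (s ⬝ᵥ (x + h) + B.F (x + h))) / 2 - 1 / 128 := by
  have hmem : ∀ t ∈ Set.Icc (0 : ℝ) 1, x + t • h ∈ interior B.K := fun t ht =>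
    B.line_mem hx (by rw [hh]; norm_num) ht
  have hd1 : ∀ t ∈ Set.Icc (0 : ℝ) 1, HasDerivAt
      (fun τ => s ⬝ᵥ (x + τ • h) + B.F (x + τ • h) - 1 / 32 * τ ^ 2)
      (s ⬝ᵥ h + h ⬝ᵥ B.grad (x + t • h) - 1 / 16 * t) t := by
    intro t ht
    have hl := hasDerivAt_line x h t
    have h1 := ((hl.dotProduct_const_left s).add (B.hasDerivAt_comp hl (hmem t ht))).sub
      ((hasDerivAt_pow 2 t).const_mul (1 / 32))
    refine h1.congr_deriv ?_
    rw [dotProduct_comm h]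
    push_cast
    ring
  have hd2 : ∀ t ∈ Set.Icc (0 : ℝ) 1, HasDerivAt
      (fun τ => s ⬝ᵥ h + h ⬝ᵥ B.grad (x + τ • h) - 1 / 16 * τ)
      (h ⬝ᵥ B.hess (x + t • h) *ᵥ h - 1 / 16) t := by
    intro t ht
    have h1 := (((B.hasDerivAt_grad_comp (hasDerivAt_line x h t)
      (hmem t ht)).dotProduct_const_left h).const_add (s ⬝ᵥ h)).sub
      ((hasDerivAt_id t).const_mul (1 / 16))
    exact h1.congr_deriv (by simp)
  have hconv := convexOn_of_hasDerivWithinAt2_nonneg (convex_Icc (0 : ℝ) 1)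
    (fun t ht => (hd1 t ht).continuousAt.continuousWithinAt)
    (fun t ht => (hd1 t (interior_subset ht)).hasDerivWithinAt)
    (fun t ht => (hd2 t (interior_subset ht)).hasDerivWithinAt)
    (fun t ht => by
      have ht := interior_subset ht
      have h1 := (B.hess_line_bounds hx hh.le (by norm_num) ht h).1
      rw [← vnorm_sq (B.hess_posdef x hx).posSemidef, hh] at h1
      nlinarith [ht.1, ht.2])
  have h1 := hconv.2 (Set.left_mem_Icc.mpr zero_le_one) (Set.right_mem_Icc.mpr zero_le_one)
    (by norm_num : (0 : ℝ) ≤ 1 / 2) (by norm_num : (0 : ℝ) ≤ 1 / 2) (by norm_num)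
  simp only [smul_eq_mul, mul_zero, zero_add, mul_one, zero_smul, add_zero, one_smul] at h1
  linarith

/-- A linear perturbation of a barrier that is bounded below attains its minimum. -/
theorem exists_forall_le (B : LHSCB n ν) (s : Fin n → ℝ)
    (hbdd : BddBelow ((fun x => s ⬝ᵥ x + B.F x) '' interior B.K)) :
    ∃ x ∈ interior B.K, ∀ y ∈ interior B.K, s ⬝ᵥ x + B.F x ≤ s ⬝ᵥ y + B.F y := by
  obtain ⟨_, ⟨x, hx, rfl⟩, hxlt⟩ := exists_lt_of_csInf_lt (B.cone_fullDim.image _)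
    (lt_add_of_pos_right (sInf ((fun x => s ⬝ᵥ x + B.F x) '' interior B.K))
      (by norm_num : (0 : ℝ) < 1 / 128))
  set S := {y | vnorm (B.hess x) (y - x) ≤ 1 / 2} with hS
  have hxS : x ∈ S := by simp [hS, vnorm]
  have hSK : S ⊆ interior B.K := fun y hy => B.dikin x hx y (lt_of_le_of_lt hy (by norm_num))
  have hFcont : ContinuousOn (fun x => s ⬝ᵥ x + B.F x) (interior B.K) :=
    (by fun_prop : Continuous fun x : Fin n → ℝ => s ⬝ᵥ x).continuousOn.add B.smooth.continuousOn
  obtain ⟨z, hzS, hz⟩ := (isCompact_setOf_vnorm_sub_le (B.hess_symm x hx) (B.hess_posdef x hx) x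
    (1 / 2)).exists_isMinOn ⟨x, hxS⟩ (hFcont.mono hSK)
  have hzlt : vnorm (B.hess x) (z - x) < 1 / 2 := by
    refine lt_of_le_of_ne hzS fun heq => ?_
    have h1 := B.midpoint_le s hx heq
    have h2 : s ⬝ᵥ z + B.F z ≤ s ⬝ᵥ x + B.F x := hz hxS
    have h3 := csInf_le hbdd (Set.mem_image_of_mem (fun x => s ⬝ᵥ x + B.F x)
      (B.line_mem hx (by rw [heq]; norm_num) (t := 1 / 2) (by norm_num)))
    rw [add_sub_cancel] at h1
    simp only at h3 hxlt
    linarith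
  have hcont : Continuous fun y => vnorm (B.hess x) (y - x) := by
    unfold vnorm
    fun_prop
  have hloc : IsLocalMinOn (fun x => s ⬝ᵥ x + B.F x) (interior B.K) z := by
    refine IsLocalMin.on ?_ _
    filter_upwards [hcont.continuousAt.preimage_mem_nhds (Iio_mem_nhds hzlt)] with y hy
    exact hz (show vnorm (B.hess x) (y - x) ≤ 1 / 2 from le_of_lt hy)
  have hlin : ConvexOn ℝ (interior B.K) fun x : Fin n → ℝ => s ⬝ᵥ x :=
    ⟨B.cone_convex.interior, fun _ _ _ _ _ _ _ _ _ => by simp [dotProduct_add]⟩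
  exact ⟨z, hSK hzS, IsMinOn.of_isLocalMinOn_of_convexOn (hSK hzS) hloc
    (hlin.add B.strictConvex.convexOn)⟩

end LHSCB

namespace LHSCBPair

variable {n : ℕ} {ν : ℝ}

theorem bddAbove_conj (P : LHSCBPair n ν) {s : Fin n → ℝ} (hs : s ∈ interior P.Bstar.K) :
    BddAbove ((fun x => -(s ⬝ᵥ x) - P.B.F x) '' interior P.B.K) := by
  by_contra hnot
  have hnot2 : ¬ BddAbove ((fun x => -(((2 : ℝ) • s) ⬝ᵥ x) - P.B.F x) '' interior P.B.K) := by
    rintro ⟨M, hM⟩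
    refine hnot ⟨M - ν * Real.log (1 / 2), ?_⟩
    rintro _ ⟨x, hx, rfl⟩
    have h1 := hM (Set.mem_image_of_mem _ (P.B.smul_mem_interior one_half_pos hx))
    simp only [P.B.logHom (1 / 2) one_half_pos x hx, smul_dotProduct, dotProduct_smul,
      smul_eq_mul] at h1
    simp only
    linarith
  have h1 := P.Bstar.logHom 2 two_pos s hs
  rw [P.conj_eq s hs, P.conj_eq _ (P.Bstar.smul_mem_interior two_pos hs),
    Real.sSup_of_not_bddAbove hnot, Real.sSup_of_not_bddAbove hnot2] at h1
  have h2 := mul_pos P.B.nu_pos (Real.log_pos one_lt_two)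
  linarith

theorem exists_grad_eq (P : LHSCBPair n ν) {s : Fin n → ℝ} (hs : s ∈ interior P.Bstar.K) :
    ∃ x ∈ interior P.B.K, P.B.grad x = -s ∧ P.Bstar.grad s = -x := by
  obtain ⟨M, hM⟩ := P.bddAbove_conj hs
  obtain ⟨x, hx, hmin⟩ := P.B.exists_forall_le s ⟨-M, by
    rintro _ ⟨y, hy, rfl⟩
    have := hM (Set.mem_image_of_mem _ hy)
    simp only at this ⊢
    linarith⟩
  refine ⟨x, hx, ?_, ?_⟩
  · refine dotProduct_eq _ _ fun v => ?_
    have hl := LHSCB.hasDerivAt_line x v 0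
    have hl0 : x + (0 : ℝ) • v ∈ interior P.B.K := by simpa using hx
    have hloc : IsLocalMin (fun τ : ℝ => s ⬝ᵥ (x + τ • v) + P.B.F (x + τ • v)) 0 := by
      filter_upwards [hl.continuousAt.preimage_mem_nhds (isOpen_interior.mem_nhds hl0)] with τ hτ
      simpa using hmin _ hτ
    have h1 := hloc.hasDerivAt_eq_zero
      ((hl.dotProduct_const_left s).add (P.B.hasDerivAt_comp hl hl0))
    rw [zero_smul, add_zero] at h1
    rw [neg_dotProduct]
    linarith
  · refine dotProduct_eq _ _ fun v => ?_
    have hl := LHSCB.hasDerivAt_line s v 0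
    have hl0 : s + (0 : ℝ) • v ∈ interior P.Bstar.K := by simpa using hs
    have hval : P.Bstar.F s = -(s ⬝ᵥ x) - P.B.F x := by
      rw [P.conj_eq s hs]
      refine IsGreatest.csSup_eq ⟨Set.mem_image_of_mem _ hx, ?_⟩
      rintro _ ⟨y, hy, rfl⟩
      linarith [hmin y hy]
    have hloc : IsLocalMin (fun τ : ℝ => x ⬝ᵥ (s + τ • v) + P.Bstar.F (s + τ • v)) 0 := by
      filter_upwards [hl.continuousAt.preimage_mem_nhds (isOpen_interior.mem_nhds hl0)] with τ hτ
      have h1 := le_csSup (P.bddAbove_conj hτ)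
        (Set.mem_image_of_mem (fun y => -((s + τ • v) ⬝ᵥ y) - P.B.F y) hx)
      rw [← P.conj_eq _ hτ] at h1
      rw [zero_smul, add_zero, hval, dotProduct_comm x s, dotProduct_comm x (s + τ • v)]
      simp only at h1
      linarith
    have h1 := hloc.hasDerivAt_eq_zero
      ((hl.dotProduct_const_left x).add (P.Bstar.hasDerivAt_comp hl hl0))
    rw [zero_smul, add_zero] at h1
    rw [neg_dotProduct]
    linarith

theorem neg_grad_mem (P : LHSCBPair n ν) {s : Fin n → ℝ} (hs : s ∈ interior P.Bstar.K) :
    -P.Bstar.grad s ∈ interior P.B.K := by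
  obtain ⟨x, hx, -, h⟩ := P.exists_grad_eq hs
  rwa [h, neg_neg]

theorem grad_neg_grad (P : LHSCBPair n ν) {s : Fin n → ℝ} (hs : s ∈ interior P.Bstar.K) :
    P.B.grad (-P.Bstar.grad s) = -s := by
  obtain ⟨x, hx, h1, h2⟩ := P.exists_grad_eq hs
  rwa [h2, neg_neg]

theorem hess_mul_hess (P : LHSCBPair n ν) {s : Fin n → ℝ} (hs : s ∈ interior P.Bstar.K) :
    P.B.hess (-P.Bstar.grad s) * P.Bstar.hess s = 1 := by
  refine ext_of_mulVec_single fun i => ?_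
  set v : Fin n → ℝ := Pi.single i 1
  have hl := LHSCB.hasDerivAt_line s v 0
  have hl0 : s + (0 : ℝ) • v ∈ interior P.Bstar.K := by simpa using hs
  have h1 := P.B.hasDerivAt_grad_comp (P.Bstar.hasDerivAt_grad_comp hl hl0).fun_neg
    (P.neg_grad_mem hl0)
  have h2 := hl.fun_neg.congr_of_eventuallyEq
    (f₁ := fun τ : ℝ => P.B.grad (-P.Bstar.grad (s + τ • v))) (by
      filter_upwards [hl.continuousAt.preimage_mem_nhds (isOpen_interior.mem_nhds hl0)] with τ hτ
      exact P.grad_neg_grad hτ)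
  have h3 := h1.unique h2
  rw [zero_smul, add_zero, mulVec_neg, neg_inj, mulVec_mulVec] at h3
  rw [h3, one_mulVec]

end LHSCBPair

namespace LHSCB

variable {n : ℕ} {ν : ℝ}

/-- Gradient increments of a barrier compared with a matrix `G` such that
`l • B.hess x ⪯ G ⪯ w • B.hess x`, in terms of the norm of `G`. -/
theorem grad_increment_bounds (B : LHSCB n ν) {x h : Fin n → ℝ} (hx : x ∈ interior B.K) {r : ℝ}
    (hhr : vnorm (B.hess x) h ≤ r) (hr : r < 1) {G : Matrix (Fin n) (Fin n) ℝ} (hGs : G.IsSymm)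
    (hG : G.PosDef) {l w : ℝ} (hl : 0 < l) (hlw : l * w ≤ 1)
    (hlG : ∀ v, l * (v ⬝ᵥ B.hess x *ᵥ v) ≤ v ⬝ᵥ G *ᵥ v)
    (hGw : ∀ v, v ⬝ᵥ G *ᵥ v ≤ w * (v ⬝ᵥ B.hess x *ᵥ v)) (u : Fin n → ℝ) :
    u ⬝ᵥ G *ᵥ h - u ⬝ᵥ (B.grad (x + h) - B.grad x) ≤
        (l⁻¹ * (1 - r)⁻¹ - 1) * (vnorm G u * vnorm G h) ∧
      -(u ⬝ᵥ (B.grad (x + h) - B.grad x)) ≤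
        l⁻¹ * (1 - r)⁻¹ * (vnorm G u * vnorm G h) := by
  have hmem : ∀ t ∈ Set.Icc (0 : ℝ) 1, x + t • h ∈ interior B.K := fun t ht =>
    B.line_mem hx (hhr.trans_lt hr) ht
  have hupper : ∀ t ∈ Set.Icc (0 : ℝ) 1, ∀ v, v ⬝ᵥ B.hess (x + t • h) *ᵥ v ≤
      l⁻¹ * ((1 - t * r) ^ 2)⁻¹ * (v ⬝ᵥ G *ᵥ v) := by
    intro t ht v
    have hq : 0 < ((1 - t * r) ^ 2)⁻¹ := inv_pos.mpr (pow_pos (one_sub_mul_pos hr ht) 2)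
    refine (B.hess_line_bounds hx hhr hr ht v).2.trans ?_
    have h1 := mul_le_mul_of_nonneg_left (hlG v) (mul_pos (inv_pos.mpr hl) hq).le
    calc _ = l⁻¹ * ((1 - t * r) ^ 2)⁻¹ * (l * (v ⬝ᵥ B.hess x *ᵥ v)) := by field_simp
      _ ≤ _ := h1
  constructor
  · have h1 := B.dotProduct_grad_sub_le (u := u) (g := u ⬝ᵥ G *ᵥ h) hr hmem
      (a := l⁻¹ * (vnorm G u * vnorm G h)) (b := vnorm G u * vnorm G h) (by
        intro t ht
        have h2 := dotProduct_mulVec_le_of_abs_quadForm_le (M := G - B.hess (x + t • h))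
          (c := l⁻¹ * ((1 - t * r) ^ 2)⁻¹ - 1) (hGs.sub (B.hess_symm _ (hmem t ht))) hG (by
            intro v
            have hq : 0 < (1 - t * r) ^ 2 := pow_pos (one_sub_mul_pos hr ht) 2
            have hY := hupper t ht v
            have hY' := (B.hess_line_bounds hx hhr hr ht v).1
            have hX := quadForm_nonneg hG.posSemidef v
            have hZ := quadForm_nonneg (B.hess_posdef x hx).posSemidef v
            have hXZ : l * (v ⬝ᵥ G *ᵥ v) ≤ v ⬝ᵥ B.hess x *ᵥ v := by
              nlinarith [mul_le_mul_of_nonneg_left (hGw v) hl.le]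
            have hqX := mul_le_mul_of_nonneg_left hXZ hq.le
            have hamgm : 2 ≤ l⁻¹ * ((1 - t * r) ^ 2)⁻¹ + l * (1 - t * r) ^ 2 := by
              have hp : 0 < l * (1 - t * r) ^ 2 := mul_pos hl hq
              rw [← mul_inv]
              have h3 : (l * (1 - t * r) ^ 2)⁻¹ * (l * (1 - t * r) ^ 2) = 1 :=
                inv_mul_cancel₀ hp.ne'
              have h4 := inv_pos.mpr hp
              nlinarith [sq_nonneg ((l * (1 - t * r) ^ 2)⁻¹ - l * (1 - t * r) ^ 2)]
            rw [sub_mulVec, dotProduct_sub, abs_le]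
            constructor
            · linarith
            · nlinarith [mul_le_mul_of_nonneg_right hamgm hX]) u h
        rw [sub_mulVec, dotProduct_sub] at h2
        linarith)
    linarith
  · have h1 := B.dotProduct_grad_sub_le (u := u) (g := 0) hr hmem
      (a := l⁻¹ * (vnorm G u * vnorm G h)) (b := 0) (by
        intro t ht
        have h2 := dotProduct_mulVec_le_of_abs_quadForm_le (M := -B.hess (x + t • h))
          (c := l⁻¹ * ((1 - t * r) ^ 2)⁻¹) (B.hess_symm _ (hmem t ht)).neg hG (by
            intro v
            rw [neg_mulVec, dotProduct_neg, abs_neg, abs_of_nonneg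
              (quadForm_nonneg (B.hess_posdef _ (hmem t ht)).posSemidef v)]
            exact hupper t ht v) u h
        rw [neg_mulVec, dotProduct_neg] at h2
        linarith)
    linarith

theorem vnorm_hess_self (B : LHSCB n ν) {x : Fin n → ℝ} (hx : x ∈ interior B.K) :
    vnorm (B.hess x) x = √ν := by
  rw [vnorm, B.hess_mulVec_self hx, dotProduct_neg, dotProduct_comm, B.grad_dotProduct_self hx,
    neg_neg]

end LHSCB

namespace LHSCBPair

variable {n : ℕ} {ν : ℝ}

/-- Bound on the pairing of the two conjugate points obtained by displacing the primal-dual pair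
`(-P.Bstar.grad s, s)` by `h` and `-G h`, where `G` is comparable to the primal Hessian. -/
theorem grad_dotProduct_grad_le (P : LHSCBPair n ν) {s : Fin n → ℝ}
    (hs : s ∈ interior P.Bstar.K) {G : Matrix (Fin n) (Fin n) ℝ} (hGs : G.IsSymm)
    (hG : G.PosDef) {l w δ : ℝ} (hl : 0 < l) (hw : 0 < w) (hl1 : l ≤ 1) (hlw : l * w ≤ 1)
    (hlG : ∀ v, l * (v ⬝ᵥ P.B.hess (-P.Bstar.grad s) *ᵥ v) ≤ v ⬝ᵥ G *ᵥ v)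
    (hGw : ∀ v, v ⬝ᵥ G *ᵥ v ≤ w * (v ⬝ᵥ P.B.hess (-P.Bstar.grad s) *ᵥ v))
    {h : Fin n → ℝ} (hδ : vnorm G h ≤ δ) (hr : δ / √l < 1) (hρ : √w * δ < 1) :
    (-P.Bstar.grad (s - G *ᵥ h)) ⬝ᵥ (-P.B.grad (-P.Bstar.grad s + h)) ≤
      ν + vnorm G (-P.Bstar.grad s) * δ * (l⁻¹ * (1 - δ / √l)⁻¹ - 1)
        + √ν * (√w * δ) * ((1 - √w * δ)⁻¹ - 1)
        + δ ^ 2 * w * (l⁻¹ * (1 - δ / √l)⁻¹ * (1 - √w * δ)⁻¹) := by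
  set x := -P.Bstar.grad s with hxdef
  have hx : x ∈ interior P.B.K := P.neg_grad_mem hs
  have hδ0 : 0 ≤ δ := (vnorm_nonneg _ _).trans hδ
  have hsl : 0 < √l := Real.sqrt_pos.mpr hl
  have hDpd := P.Bstar.hess_posdef s hs
  have hDs := P.Bstar.hess_symm s hs
  have hHr : vnorm (P.B.hess x) h ≤ δ / √l := by
    rw [le_div_iff₀ hsl, mul_comm]
    refine le_trans ?_ hδ
    unfold vnorm
    rw [← Real.sqrt_mul hl.le]
    exact Real.sqrt_le_sqrt (hlG h)
  have hDle := vnorm_mulVec_le hGs hG hDpd (P.hess_mul_hess hs) hw.le hGw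
  have hΔ : vnorm (P.Bstar.hess s) (-(G *ᵥ h)) ≤ √w * δ := by
    have h1 := vnorm_smul (P.Bstar.hess s) (-1) (G *ᵥ h)
    rw [neg_one_smul, abs_neg, abs_one, one_mul] at h1
    rw [h1]
    exact (hDle h).trans (mul_le_mul_of_nonneg_left hδ (Real.sqrt_nonneg _))
  have hr' : 0 < (1 - δ / √l)⁻¹ := inv_pos.mpr (by linarith)
  have hρ' : 0 < (1 - √w * δ)⁻¹ := inv_pos.mpr (by linarith)
  have hr1 : 1 ≤ (1 - δ / √l)⁻¹ :=
    (one_le_inv₀ (by linarith)).mpr (by linarith [div_nonneg hδ0 hsl.le])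
  have hρ1 : 1 ≤ (1 - √w * δ)⁻¹ :=
    (one_le_inv₀ (by linarith)).mpr (by linarith [mul_nonneg (Real.sqrt_nonneg w) hδ0])
  have hl1' : 1 ≤ l⁻¹ := (one_le_inv₀ hl).mpr hl1
  have primal := P.B.grad_increment_bounds hx hHr hr hGs hG hl hlw hlG hGw
  have dual := P.Bstar.grad_increment_bounds hs hΔ hρ hDs hDpd one_pos (by norm_num)
    (fun v => (one_mul _).le) (fun v => (one_mul _).ge)
  rw [P.grad_neg_grad hs] at primal
  rw [← sub_eq_add_neg] at dual
  simp only [inv_one, one_mul] at dual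
  set A := -P.Bstar.grad (s - G *ᵥ h) - x with hA
  set C := -P.B.grad (x + h) - s with hC
  have eA : P.Bstar.grad (s - G *ᵥ h) - P.Bstar.grad s = -A := by rw [hA, hxdef]; abel
  have eC : P.B.grad (x + h) - -s = -C := by rw [hC]; abel
  rw [eA] at dual
  rw [eC] at primal
  simp only [dotProduct_neg, sub_neg_eq_add, neg_neg] at primal dual
  have hsum : (-P.Bstar.grad (s - G *ᵥ h)) ⬝ᵥ (-P.B.grad (x + h)) =
      ν + (x ⬝ᵥ G *ᵥ h + x ⬝ᵥ C) +
        (s ⬝ᵥ P.Bstar.hess s *ᵥ (-(G *ᵥ h)) + s ⬝ᵥ A) + A ⬝ᵥ C := by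
    have e1 : -P.Bstar.grad (s - G *ᵥ h) = x + A := by rw [hA]; abel
    have e2 : -P.B.grad (x + h) = s + C := by rw [hC]; abel
    have e3 : x ⬝ᵥ s = ν := by
      rw [hxdef, neg_dotProduct, P.Bstar.grad_dotProduct_self hs, neg_neg]
    have e4 : s ⬝ᵥ P.Bstar.hess s *ᵥ (-(G *ᵥ h)) = -(x ⬝ᵥ G *ᵥ h) := by
      rw [hDs.dotProduct_mulVec_comm, P.Bstar.hess_mulVec_self hs, ← hxdef, neg_dotProduct,
        dotProduct_comm]
    rw [e1, e2, e4, dotProduct_comm s A, add_dotProduct, dotProduct_add,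
      dotProduct_add, e3]
    ring
  have hAG : vnorm G A ≤ w * δ * (1 - √w * δ)⁻¹ := by
    have h1 := (dual (G *ᵥ A)).2
    rw [dotProduct_comm, ← vnorm_sq hG.posSemidef] at h1
    have h2 : vnorm (P.Bstar.hess s) (G *ᵥ A) * vnorm (P.Bstar.hess s) (-(G *ᵥ h)) ≤
        (√w * vnorm G A) * (√w * δ) :=
      mul_le_mul (hDle A) hΔ (vnorm_nonneg _ _)
        (mul_nonneg (Real.sqrt_nonneg _) (vnorm_nonneg _ _))
    have h3 := h1.trans (mul_le_mul_of_nonneg_left h2 hρ'.le)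
    have h4 : √w * √w = w := Real.mul_self_sqrt hw.le
    have h5 : vnorm G A * vnorm G A ≤ vnorm G A * (w * δ * (1 - √w * δ)⁻¹) := by
      rw [← sq]
      refine h3.trans_eq ?_
      linear_combination (1 - √w * δ)⁻¹ * vnorm G A * δ * h4
    rcases (vnorm_nonneg G A).eq_or_lt with h0 | h0
    · rw [← h0]; positivity
    · exact le_of_mul_le_mul_left h5 h0
  have b1 : x ⬝ᵥ G *ᵥ h + x ⬝ᵥ C ≤ vnorm G x * δ * (l⁻¹ * (1 - δ / √l)⁻¹ - 1) := by
    refine (primal x).1.trans ?_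
    rw [mul_comm]
    refine mul_le_mul_of_nonneg_right (mul_le_mul_of_nonneg_left hδ (vnorm_nonneg _ _)) ?_
    nlinarith
  have b2 : s ⬝ᵥ P.Bstar.hess s *ᵥ (-(G *ᵥ h)) + s ⬝ᵥ A ≤
      √ν * (√w * δ) * ((1 - √w * δ)⁻¹ - 1) := by
    refine (dual s).1.trans ?_
    rw [mul_comm, P.Bstar.vnorm_hess_self hs]
    refine mul_le_mul_of_nonneg_right (mul_le_mul_of_nonneg_left hΔ (Real.sqrt_nonneg _)) ?_
    linarith
  have b3 : A ⬝ᵥ C ≤ δ ^ 2 * w * (l⁻¹ * (1 - δ / √l)⁻¹ * (1 - √w * δ)⁻¹) := by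
    refine (primal A).2.trans ?_
    have h1 : vnorm G A * vnorm G h ≤ w * δ * (1 - √w * δ)⁻¹ * δ :=
      mul_le_mul hAG hδ (vnorm_nonneg _ _) (by positivity)
    refine (mul_le_mul_of_nonneg_left h1 (by positivity)).trans_eq ?_
    ring
  rw [hsum]
  linarith

end LHSCBPair

/-- Bound on the shadow inner product `μ₊ μ̃₊₊` after the corrector step. -/
theorem stmt17 {n : ℕ} {ν : ℝ} (Bp : LHSCBPair n ν)
    (xp sp : Fin n → ℝ) (hxp : xp ∈ interior Bp.B.K) (hsp : sp ∈ interior Bp.Bstar.K)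
    (τp κp : ℝ) (hτ : 0 < τp) (hκ : 0 < κp)
    (stp xtp : Fin n → ℝ) (hstp : stp = -Bp.B.grad xp) (hxtp : xtp = -Bp.Bstar.grad sp)
    (μp : ℝ) (hμp : μp = xp ⬝ᵥ sp / ν)
    (δPp : Fin n → ℝ) (hδPp : δPp = xp - μp • xtp)
    (Wp : Matrix (Fin n) (Fin n) ℝ) (hWsymm : Wp.IsSymm) (hWpd : Wp.PosDef)
    (hWx : Wp *ᵥ xp = sp) (hWxt : Wp *ᵥ xtp = stp)
    (lD uD lam ε : ℝ) (hlam0 : 0 < lam) (hlam1 : lam ≤ 1) (hε : 0 ≤ ε)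
    (huD : uD = (1 + ε) / lam) (hlD : lD = lam * (1 - ε))
    (hWD1 : Loewner ((lD / μp) • (Bp.Bstar.hess sp)⁻¹) Wp)
    (hWD2 : Loewner Wp ((uD / μp) • (Bp.Bstar.hess sp)⁻¹))
    (Δx Δs : Fin n → ℝ) (Δτ Δκ : ℝ)
    (hdir1 : Wp *ᵥ Δx + Δs = μp • stp - sp)
    (hdir2 : τp * Δκ + κp * Δτ = 0)
    (hdir3 : Δx ⬝ᵥ Δs + Δτ * Δκ = 0)
    (d : ℝ) (hd : d = vnorm Wp δPp)
    (hdsmall : d / Real.sqrt μp < Real.sqrt (min lD (1 / uD)))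
    (hxpp : xp + Δx ∈ interior Bp.B.K) (hspp : sp + Δs ∈ interior Bp.Bstar.K)
    (μtpp : ℝ)
    (hμtpp : μtpp = (-Bp.Bstar.grad (sp + Δs)) ⬝ᵥ (-Bp.B.grad (xp + Δx)) / ν) :
    μp * μtpp ≤
      1 + d * ((vnorm Wp xtp / ν) * (1 / (lD * (1 - d / Real.sqrt (lD * μp))) - 1)
          + (uD / Real.sqrt (μp * ν)) * (1 / (1 - Real.sqrt (uD / μp) * d) - 1))
        + d ^ 2 * uD /
            (μp * ν * lD * (1 - d / Real.sqrt (lD * μp)) * (1 - Real.sqrt (uD / μp) * d)) := by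
  have hν := Bp.B.nu_pos
  have hxp0 : xp ≠ 0 := fun h => Bp.B.zero_notMem (h ▸ hxp)
  have hμ : 0 < μp := by
    rw [hμp, ← hWx]
    exact div_pos (by simpa using hWpd.dotProduct_mulVec_pos hxp0) hν
  have hd0 : 0 ≤ d := hd ▸ vnorm_nonneg _ _
  have hsμ : 0 < √μp := Real.sqrt_pos.mpr hμ
  have hu1 : 1 ≤ uD := by rw [huD, one_le_div hlam0]; linarith
  have hu0 : 0 < uD := by linarith
  have hl0 : 0 < lD :=
    (Real.sqrt_pos.mp ((div_nonneg hd0 hsμ.le).trans_lt hdsmall)).trans_le (min_le_left _ _)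
  have hl1 : lD ≤ 1 := by rw [hlD]; nlinarith
  have hlu : lD * uD ≤ 1 := by
    have : lD * uD = 1 - ε ^ 2 := by rw [hlD, huD]; field_simp; ring
    nlinarith
  have hsl : 0 < √lD := Real.sqrt_pos.mpr hl0
  have hsu : 0 < √uD := Real.sqrt_pos.mpr hu0
  have hr : d / √μp / √lD < 1 := by
    rw [div_lt_one hsl]
    exact hdsmall.trans_le (Real.sqrt_le_sqrt (min_le_left _ _))
  have hρ : √uD * (d / √μp) < 1 := by
    have h1 := hdsmall.trans_le (Real.sqrt_le_sqrt (min_le_right lD (1 / uD)))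
    rw [Real.sqrt_div zero_le_one, Real.sqrt_one, lt_div_iff₀ hsu] at h1
    linarith
  have hH : (Bp.Bstar.hess sp)⁻¹ = Bp.B.hess xtp := by
    rw [hxtp]
    exact inv_eq_left_inv (Bp.hess_mul_hess hsp)
  rw [hH] at hWD1 hWD2
  have hlG : ∀ v, lD * (v ⬝ᵥ Bp.B.hess xtp *ᵥ v) ≤ v ⬝ᵥ (μp • Wp) *ᵥ v := by
    intro v
    have h1 := hWD1.quadForm_le v
    simp only [smul_mulVec, dotProduct_smul, smul_eq_mul] at h1 ⊢
    rw [div_mul_eq_mul_div, div_le_iff₀ hμ] at h1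
    linarith
  have hGw : ∀ v, v ⬝ᵥ (μp • Wp) *ᵥ v ≤ uD * (v ⬝ᵥ Bp.B.hess xtp *ᵥ v) := by
    intro v
    have h1 := hWD2.quadForm_le v
    simp only [smul_mulVec, dotProduct_smul, smul_eq_mul] at h1 ⊢
    rw [div_mul_eq_mul_div, le_div_iff₀ hμ] at h1
    linarith
  have hGnorm : ∀ v, vnorm (μp • Wp) v = √μp * vnorm Wp v := by
    intro v
    unfold vnorm
    rw [smul_mulVec, dotProduct_smul, smul_eq_mul, Real.sqrt_mul hμ.le]
  set h := xp + Δx - μp • xtp with hh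
  have hWh : Wp *ᵥ h = -Δs := by
    rw [hh, mulVec_sub, mulVec_add, mulVec_smul, hWx, hWxt, eq_sub_of_add_eq hdir1]
    abel
  have hnorm : vnorm Wp h ≤ d := by
    have h1 : Δτ * Δκ ≤ 0 := by
      have h2 : τp * (Δτ * Δκ) = -(κp * Δτ ^ 2) := by linear_combination Δτ * hdir2
      have h3 : 0 ≤ κp * Δτ ^ 2 := by positivity
      exact nonpos_of_mul_nonpos_right (by linarith) hτ
    have h2 : Δx = h - δPp := by rw [hh, hδPp]; abel
    have h3 : Δs = -(Wp *ᵥ h) := by rw [hWh, neg_neg]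
    rw [h2, h3, dotProduct_neg, sub_dotProduct, ← vnorm_sq hWpd.posSemidef] at hdir3
    have h4 := dotProduct_mulVec_le_vnorm_mul hWsymm hWpd δPp h
    rw [← hd] at h4
    have h5 := vnorm_nonneg Wp h
    rcases h5.eq_or_lt with h0 | h0
    · linarith
    · exact le_of_mul_le_mul_right (by nlinarith) h0
  have hδ : vnorm (μp • Wp) (μp⁻¹ • h) ≤ d / √μp := by
    rw [hGnorm, vnorm_smul, abs_of_pos (inv_pos.mpr hμ), le_div_iff₀ hsμ]
    have : √μp * √μp = μp := Real.mul_self_sqrt hμ.le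
    calc √μp * (μp⁻¹ * vnorm Wp h) * √μp = (√μp * √μp) * μp⁻¹ * vnorm Wp h := by ring
      _ = vnorm Wp h := by rw [this, mul_inv_cancel₀ hμ.ne', one_mul]
      _ ≤ d := hnorm
  have main := Bp.grad_dotProduct_grad_le hsp (hWsymm.smul μp) (hWpd.smul hμ) hl0 hu0 hl1 hlu
    (by rwa [← hxtp]) (by rwa [← hxtp]) hδ hr hρ
  have eG : sp - (μp • Wp) *ᵥ (μp⁻¹ • h) = sp + Δs := by
    rw [smul_mulVec, mulVec_smul, smul_smul, mul_inv_cancel₀ hμ.ne', one_smul, hWh, sub_neg_eq_add]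
  have ex : xtp + μp⁻¹ • h = μp⁻¹ • (xp + Δx) := by
    rw [hh, smul_sub, smul_smul, inv_mul_cancel₀ hμ.ne', one_smul]
    abel
  have eg : Bp.B.grad (μp⁻¹ • (xp + Δx)) = μp • Bp.B.grad (xp + Δx) := by
    rw [← Bp.B.smul_grad_smul (inv_pos.mpr hμ) hxpp, smul_smul, mul_inv_cancel₀ hμ.ne', one_smul]
  rw [eG, ← hxtp, ex, eg, hGnorm, ← smul_neg, dotProduct_smul, smul_eq_mul] at main
  have er : d / √(lD * μp) = d / √μp / √lD := by
    rw [Real.sqrt_mul hl0.le, div_div, mul_comm √μp]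
  have eρ : √(uD / μp) * d = √uD * (d / √μp) := by
    rw [Real.sqrt_div hu0.le]
    ring
  rw [hμtpp, er, eρ]
  set a := 1 - d / √μp / √lD with ha
  set b := 1 - √uD * (d / √μp) with hb
  have ha0 : 0 < a := by linarith
  have hb0 : 0 < b := by linarith
  have hb1 : 1 ≤ b⁻¹ :=
    (one_le_inv₀ hb0).mpr (by linarith [mul_nonneg hsu.le (div_nonneg hd0 hsμ.le)])
  have hsν : 0 < √ν := Real.sqrt_pos.mpr hν
  have hsu_le : √uD ≤ uD := Real.sqrt_le_iff.mpr ⟨hu0.le, by nlinarith⟩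
  have hsecond : √ν * (√uD * (d / √μp)) * (b⁻¹ - 1) ≤
      √ν * (uD * (d / √μp)) * (b⁻¹ - 1) := by
    have : 0 ≤ b⁻¹ - 1 := by linarith
    gcongr
  have hmul := mul_le_mul_of_nonneg_left (main.trans
    (add_le_add_left (add_le_add_right hsecond _) _)) (inv_pos.mpr hν).le
  have eμ : √μp ^ 2 = μp := Real.sq_sqrt hμ.le
  have eν : √ν ^ 2 = ν := Real.sq_sqrt hν.le
  have e1 : √μp * vnorm Wp xtp * (d / √μp) = vnorm Wp xtp * d := by field_simp
  have e2 : ν⁻¹ * (√ν * (uD * (d / √μp))) = d * (uD / √(μp * ν)) := by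
    rw [Real.sqrt_mul hμ.le]
    nth_rewrite 1 [← eν]
    field_simp
  have e3 : (d / √μp) ^ 2 = d ^ 2 / μp := by rw [div_pow, eμ]
  rw [e1, e3] at hmul
  calc _ = ν⁻¹ * (μp * (-Bp.Bstar.grad (sp + Δs) ⬝ᵥ -Bp.B.grad (xp + Δx))) := by ring
    _ ≤ _ := hmul
    _ = 1 + d * (vnorm Wp xtp / ν) * (1 / (lD * a) - 1)
          + ν⁻¹ * (√ν * (uD * (d / √μp))) * (1 / b - 1)
          + d ^ 2 * uD / (μp * ν * lD * a * b) := by field_simp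
    _ = _ := by rw [e2]; ring
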